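/- Suppose the unital (k,p,q)-differential condition holds. Let I be a closed two-sided *-ideal of A (closed under the involution) possessing a bounded left approximate identity: a net (e_j) in I with sup_j ‖e_j‖_A < ∞ and e_j·x → x for every x ∈ I. Then for every a ∈ I and every ε > 0 there exist b₁, b₂ ∈ I such that ‖a − b₁·a‖_A < ε and b₂·b₁ = b₁. -/

import Mathlib

open MeasureTheory Filter Topology

/-- The one-parameter family `t ↦ exp (2πit • x)` in a complex Banach algebra. -/
noncomputable def expWave {A : Type*} [NormedRing A] [NormedAlgebra ℂ A] (x : A) (t : ℝ) : A :=
  NormedSpace.exp ((2 * Real.pi * t * Complex.I : ℂ) • x)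

/-- The inverse Fourier transform of `c`, evaluated at an element of a complex Banach algebra. -/
noncomputable def expTransform {A : Type*} [NormedRing A] [NormedAlgebra ℂ A]
    (c : ℝ → ℂ) (x : A) : A :=
  ∫ t : ℝ, c t • expWave x t

section BanachAlgebra

variable {A : Type*} [NormedRing A] [NormedAlgebra ℂ A] [CompleteSpace A]

theorem norm_exp_mul_sub_self_le (y a : A) :
    ‖NormedSpace.exp y * a - a‖ ≤ Real.exp ‖y‖ * ‖y * a‖ := by
  have h := (NormedSpace.exp_series_hasSum_exp' (𝕂 := ℂ) y).mul_right a
  rw [← hasSum_nat_add_iff' 1] at h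
  have hr : HasSum (fun n : ℕ => ‖y‖ ^ n / n.factorial * ‖y * a‖) (Real.exp ‖y‖ * ‖y * a‖) := by
    rw [Real.exp_eq_exp_ℝ]
    exact (NormedSpace.expSeries_div_hasSum_exp ‖y‖).mul_right _
  have := h.tsum_eq
  simp only [Finset.range_one, Finset.sum_singleton, Nat.factorial_zero, Nat.cast_one, inv_one,
    pow_zero, one_smul, one_mul] at this
  rw [← this]
  refine tsum_of_norm_bounded hr fun n => ?_
  rw [smul_mul_assoc, norm_smul, pow_succ, mul_assoc]
  have h1 : ‖y ^ n * (y * a)‖ ≤ ‖y‖ ^ n * ‖y * a‖ := by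
    induction n with
    | zero => simp
    | succ n ih =>
      rw [pow_succ', mul_assoc, pow_succ', mul_assoc]
      exact (norm_mul_le _ _).trans (by gcongr)
  have h2 : ‖(((n + 1).factorial : ℂ))⁻¹‖ ≤ ((n.factorial : ℝ))⁻¹ := by
    rw [norm_inv, Complex.norm_natCast]
    gcongr
    omega
  calc _ ≤ ((n.factorial : ℝ))⁻¹ * (‖y‖ ^ n * ‖y * a‖) := by gcongr
    _ = _ := by ring

theorem norm_two_pi_mul_I (t : ℝ) : ‖(2 * Real.pi * t * Complex.I : ℂ)‖ = 2 * Real.pi * |t| := by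
  simp [abs_of_pos Real.pi_pos]

theorem norm_expWave_mul_sub_self_le (x a : A) (t : ℝ) :
    ‖expWave x t * a - a‖ ≤ Real.exp (2 * Real.pi * |t| * ‖x‖) * (2 * Real.pi * |t| * ‖x * a‖) := by
  have h := norm_exp_mul_sub_self_le ((2 * Real.pi * t * Complex.I : ℂ) • x) a
  rwa [smul_mul_assoc, norm_smul, norm_smul, norm_two_pi_mul_I] at h

theorem continuous_expWave (x : A) : Continuous (expWave x) := by
  let +nondep : NormedAlgebra ℚ A := .restrictScalars ℚ ℂ A
  unfold expWave
  exact NormedSpace.exp_continuous.comp (by fun_prop)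

theorem map_expWave {B : Type*} [NormedRing B] [NormedAlgebra ℂ B]
    (T : A →ₐ[ℂ] B) (hT : Continuous T) (x : A) (t : ℝ) :
    T (expWave x t) = expWave (T x) t := by
  let +nondep : NormedAlgebra ℚ A := .restrictScalars ℚ ℂ A
  let +nondep : NormedAlgebra ℚ B := .restrictScalars ℚ ℂ B
  rw [expWave, NormedSpace.map_exp T hT, map_smul, expWave]

theorem map_expTransform {B : Type*} [NormedRing B] [NormedAlgebra ℂ B] [CompleteSpace B]
    (T : A →ₐ[ℂ] B) (hT : Continuous T) {c : ℝ → ℂ} {x : A}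
    (hc : Integrable fun t => c t • expWave x t) :
    T (expTransform c x) = expTransform c (T x) := by
  have := ContinuousLinearMap.integral_comp_comm (⟨T.toLinearMap, hT⟩ : A →L[ℂ] B) hc
  simp only [expTransform, ← map_expWave T hT]
  simp only [← map_smul]
  exact this.symm

theorem expWave_nat_mul (x : A) (k : ℕ) (t : ℝ) : expWave x (k * t) = expWave x t ^ k := by
  let +nondep : NormedAlgebra ℚ A := .restrictScalars ℚ ℂ A
  rw [expWave, expWave, ← NormedSpace.exp_nsmul, ← Nat.cast_smul_eq_nsmul ℂ, smul_smul]
  push_cast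
  ring_nf

theorem integrable_smul_expWave {c : ℝ → ℂ} {x : A} {w : ℝ → ℝ}
    (hc : AEStronglyMeasurable c) (hw : Integrable fun t => w t * ‖c t‖)
    (hx : ∀ t, ‖expWave x t‖ ≤ w t) : Integrable fun t => c t • expWave x t := by
  refine hw.mono' (hc.smul (continuous_expWave x).aestronglyMeasurable) (.of_forall fun t => ?_)
  rw [norm_smul, mul_comm]
  gcongr
  exact hx t

end BanachAlgebra

theorem expWave_complex (x : ℂ) (t : ℝ) :
    expWave x t = Complex.exp (2 * Real.pi * t * Complex.I * x) := by
  rw [expWave, Complex.exp_eq_exp_ℂ, smul_eq_mul]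

section CStar

variable {B : Type*} [CStarAlgebra B]

theorem norm_expWave_le_one {b : B} (hb : IsSelfAdjoint b) (t : ℝ) : ‖expWave b t‖ ≤ 1 := by
  cases subsingleton_or_nontrivial B
  · simp [Subsingleton.elim (expWave b t) 0]
  have hs : IsSelfAdjoint ((2 * Real.pi * t : ℝ) • b) := (IsSelfAdjoint.all _).smul hb
  have := (selfAdjoint.expUnitary ⟨_, hs⟩).2
  have h2 := CStarRing.norm_of_mem_unitary this
  rw [selfAdjoint.expUnitary_coe] at h2
  rw [expWave, ← h2]
  refine le_of_eq ?_
  congr 2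
  simp only [← Complex.coe_smul, smul_smul]
  push_cast
  ring_nf

theorem integrable_smul_expWave_of_isSelfAdjoint {b : B} (hb : IsSelfAdjoint b) {c : ℝ → ℂ}
    (hc : Integrable c) : Integrable fun t => c t • expWave b t :=
  integrable_smul_expWave (w := fun _ => 1) hc.1 (by simpa using hc.norm)
    (norm_expWave_le_one hb)

theorem expTransform_mul_eq_of_isSelfAdjoint {b : B} (hb : IsSelfAdjoint b) {c d : ℝ → ℂ}
    (hc : Integrable c) (hd : Integrable d)
    (h : ∀ x : ℝ, expTransform d (x : ℂ) * expTransform c (x : ℂ) = expTransform c (x : ℂ)) :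
    expTransform d b * expTransform c b = expTransform c b := by
  have hn : IsStarNormal b := hb.isStarNormal
  let X : C(spectrum ℂ b, ℂ) := .restrict (spectrum ℂ b) (.id ℂ)
  have hX : IsSelfAdjoint X := by
    ext z
    exact (congrArg star (hb.mem_spectrum_eq_re z.2)).trans
      ((Complex.conj_ofReal _).trans (hb.mem_spectrum_eq_re z.2).symm)
  let T := (cfcHom hn : C(spectrum ℂ b, ℂ) →⋆ₐ[ℂ] B)
  have hT : Continuous T := cfcHom_continuous hn
  have hTX : T X = b := cfcHom_id hn
  have key : ∀ {f : ℝ → ℂ}, Integrable f → expTransform f b = T (expTransform f X) := by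
    intro f hf
    have := map_expTransform (T : C(spectrum ℂ b, ℂ) →ₐ[ℂ] B) hT
      (integrable_smul_expWave_of_isSelfAdjoint hX hf)
    exact ((congrArg _ hTX).symm.trans this.symm)
  have ev : ∀ {f : ℝ → ℂ}, Integrable f → ∀ z, expTransform f X z = expTransform f (X z) := by
    intro f hf z
    exact map_expTransform (ContinuousMap.evalAlgHom ℂ ℂ z) (continuous_eval_const z)
      (integrable_smul_expWave_of_isSelfAdjoint hX hf)
  rw [key hc, key hd, ← map_mul]
  congr 1
  ext z
  rw [ContinuousMap.mul_apply, ev hc, ev hd]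
  have : X z = ((z : ℂ).re : ℂ) := hb.mem_spectrum_eq_re z.2
  rw [this, h]

end CStar

theorem exists_subexponential_bound {k : ℕ} (hk : 2 ≤ k) {p : ℝ} (hp : 0 < p) (hpk : p < k)
    (C : ℝ) :
    ∃ γ : ℝ, 0 < γ ∧ γ < 1 ∧ ∀ M : ℝ, ∃ K : ℝ, 0 ≤ K ∧ ∀ g : ℝ → ℝ, (∀ t, 0 ≤ g t) →
      (∀ t : ℝ, |t| ≤ k → g t ≤ M) → (∀ t, g (k * t) ≤ C * g t ^ p) →
      ∀ t, g t ≤ Real.exp (K * max 1 |t| ^ γ) := by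
  have hk' : (2 : ℝ) ≤ k := by exact_mod_cast hk
  obtain ⟨r, hpr, hr1, hrk⟩ : ∃ r : ℝ, p ≤ r ∧ 1 < r ∧ r < k :=
    ⟨max p ((1 + k) / 2), le_max_left _ _, lt_max_of_lt_right (by linarith),
      max_lt hpk (by linarith)⟩
  have hlk : 0 < Real.log k := Real.log_pos (by linarith)
  have hlr : 0 < Real.log r := Real.log_pos hr1
  set γ := Real.log r / Real.log k with hγ
  have hγ0 : 0 < γ := div_pos hlr hlk
  have hkγ : (k : ℝ) ^ γ = r := by
    rw [Real.rpow_def_of_pos (by linarith), hγ, mul_div_cancel₀ _ hlk.ne',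
      Real.exp_log (by linarith)]
  refine ⟨γ, hγ0, (div_lt_one hlk).2 (Real.log_lt_log (by linarith) hrk), fun M => ?_⟩
  set D := Real.log (max C 1) / (r - 1) with hD
  have hC0 : 0 ≤ Real.log (max C 1) := Real.log_nonneg (le_max_right _ _)
  have hD0 : 0 ≤ D := div_nonneg hC0 (by linarith)
  have hM0 : 0 ≤ Real.log (max M 1) := Real.log_nonneg (le_max_right _ _)
  set K := Real.log (max M 1) + D with hK
  refine ⟨K, by positivity, fun g hg0 hgM hg t => ?_⟩
  set F : ℝ → ℝ := fun t => Real.log (max (g t) 1) with hF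
  have hpos : ∀ t, 0 < max (g t) 1 := fun t => lt_max_of_lt_right one_pos
  have hone : ∀ t, 1 ≤ max (g t) 1 := fun t => le_max_right _ _
  have hFk : ∀ t, F (k * t) + D ≤ r * (F t + D) := by
    intro t
    have h1 : max (g (k * t)) 1 ≤ max C 1 * max (g t) 1 ^ r := by
      refine max_le ((hg t).trans ?_)
        (one_le_mul_of_one_le_of_one_le (le_max_right _ _)
          (Real.one_le_rpow (hone t) (by linarith)))
      have h2 : g t ^ p ≤ max (g t) 1 ^ r :=
        (Real.rpow_le_rpow (hg0 t) (le_max_left _ _) hp.le).trans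
          (Real.rpow_le_rpow_of_exponent_le (hone t) hpr)
      exact mul_le_mul (le_max_left _ _) h2 (Real.rpow_nonneg (hg0 t) _) (by positivity)
    have h3 : F (k * t) ≤ Real.log (max C 1) + r * F t := by
      have := Real.log_le_log (hpos _) h1
      rwa [Real.log_mul (by positivity) (Real.rpow_pos_of_pos (hpos t) _).ne',
        Real.log_rpow (hpos t)] at this
    have h4 : D * (r - 1) = Real.log (max C 1) := div_mul_cancel₀ _ (by linarith)
    linarith
  have hmax : ∀ t : ℝ, 1 ≤ max 1 |t| ^ γ := fun t =>
    Real.one_le_rpow (le_max_left _ _) hγ0.le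
  have hbase : ∀ t : ℝ, |t| ≤ k → F t + D ≤ K * max 1 |t| ^ γ := by
    intro t ht
    have h1 : F t ≤ Real.log (max M 1) :=
      Real.log_le_log (hpos t) (max_le_max (hgM t ht) le_rfl)
    have h2 : K ≤ K * max 1 |t| ^ γ := le_mul_of_one_le_right (by positivity) (hmax t)
    linarith
  have hind : ∀ n : ℕ, ∀ t : ℝ, |t| ≤ (k : ℝ) ^ (n + 1) → F t + D ≤ K * max 1 |t| ^ γ := by
    intro n
    induction n with
    | zero => intro t ht; exact hbase t (by simpa using ht)
    | succ n ih =>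
      intro t ht
      rcases le_total |t| k with h | h
      · exact hbase t h
      have hk0 : (0 : ℝ) < k := by linarith
      have hs : |t / k| = |t| / k := by rw [abs_div, abs_of_pos hk0]
      have h1 := ih (t / k) (by
        rw [hs, div_le_iff₀ hk0, ← pow_succ]; exact ht)
      have h2 := hFk (t / k)
      rw [mul_div_cancel₀ _ hk0.ne'] at h2
      have h3 : r * max 1 |t / k| ^ γ = max 1 |t| ^ γ := by
        rw [hs, max_eq_right ((one_le_div hk0).2 h), max_eq_right (by linarith), ← hkγ,
          ← Real.mul_rpow hk0.le (by positivity), mul_div_cancel₀ _ hk0.ne']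
      calc F t + D ≤ r * (F (t / k) + D) := h2
        _ ≤ r * (K * max 1 |t / k| ^ γ) := by gcongr
        _ = _ := by rw [← h3]; ring
  obtain ⟨n, hn⟩ := pow_unbounded_of_one_lt |t| (show (1 : ℝ) < k by linarith)
  have h1 := hind n t (hn.le.trans (pow_le_pow_right₀ (by linarith) (by omega)))
  calc g t ≤ max (g t) 1 := le_max_left _ _
    _ = Real.exp (F t) := (Real.exp_log (hpos t)).symm
    _ ≤ _ := Real.exp_le_exp.2 (by linarith)

section Ideal

variable {A : Type*} [NormedRing A] [NormedAlgebra ℂ A] [CompleteSpace A]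

theorem exp_sub_one_mem {I : Submodule ℂ A} (hI : IsClosed (I : Set A))
    (hmul : ∀ a x : A, x ∈ I → a * x ∈ I) {y : A} (hy : y ∈ I) : NormedSpace.exp y - 1 ∈ I := by
  have h := NormedSpace.exp_series_hasSum_exp' (𝕂 := ℂ) y
  rw [← hasSum_nat_add_iff' 1] at h
  simp only [Finset.range_one, Finset.sum_singleton, Nat.factorial_zero, Nat.cast_one, inv_one,
    pow_zero, one_smul] at h
  refine hI.mem_of_tendsto h (.of_forall fun s => I.sum_mem fun n _ => I.smul_mem _ ?_)
  rw [pow_succ]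
  exact hmul _ _ hy

theorem expTransform_mem {I : Submodule ℂ A} (hI : IsClosed (I : Set A))
    (hmul : ∀ a x : A, x ∈ I → a * x ∈ I) {u : A} (hu : 1 - u ∈ I) {c : ℝ → ℂ}
    (hc : Integrable fun t => c t • expWave u t) (h1 : expTransform c (1 : ℂ) = 0) :
    expTransform c u ∈ I := by
  let +nondep : NormedAlgebra ℚ A := .restrictScalars ℚ ℂ A
  have hwave : ∀ t, I.mkQ (expWave u t) = expWave (1 : ℂ) t • I.mkQ 1 := by
    intro t
    rw [← map_smul, ← sub_eq_zero, ← map_sub, Submodule.mkQ_apply, Submodule.Quotient.mk_eq_zero]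
    have h2 : expWave (1 : A) t = expWave (1 : ℂ) t • 1 := by
      have := map_expWave (Algebra.ofId ℂ A) (continuous_algebraMap ℂ A) 1 t
      rw [map_one] at this
      rw [← this, ← Algebra.algebraMap_eq_smul_one]
      rfl
    set s : ℂ := 2 * Real.pi * t * Complex.I with hs
    have h3 : expWave u t = expWave 1 t * NormedSpace.exp (s • (u - 1)) := by
      rw [expWave, expWave, ← NormedSpace.exp_add_of_commute, ← hs, ← smul_add,
        add_sub_cancel]
      exact ((Commute.one_left _).smul_left _)
    rw [← h2, h3, ← mul_sub_one]
    refine hmul _ _ (exp_sub_one_mem hI hmul (I.smul_mem _ ?_))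
    rw [← neg_sub]
    exact I.neg_mem hu
  have : IsClosed (I : Set A) := hI
  rw [← Submodule.Quotient.mk_eq_zero, ← Submodule.mkQ_apply]
  have h := ContinuousLinearMap.integral_comp_comm I.mkQL hc
  have h' : I.mkQ (expTransform c u) = ∫ t, I.mkQ (c t • expWave u t) := h.symm
  rw [h']
  simp only [map_smul, hwave, smul_smul]
  rw [integral_smul_const]
  have h4 : ∫ t, c t * expWave (1 : ℂ) t = 0 := h1
  rw [h4, zero_smul]

theorem tendsto_expTransform_mul {u : ℕ → A} {a : A} {c : ℝ → ℂ} {w : ℝ → ℝ} {R : ℝ}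
    (hcm : AEStronglyMeasurable c) (hcw : Integrable fun t => w t * ‖c t‖)
    (hR : ∀ n, ‖u n‖ ≤ R) (hw : ∀ n t, ‖expWave (u n) t‖ ≤ w t)
    (h0 : expTransform c (0 : ℂ) = 1) (hu : Tendsto (fun n => u n * a) atTop (𝓝 0)) :
    Tendsto (fun n => expTransform c (u n) * a) atTop (𝓝 a) := by
  have hint : ∀ n, expTransform c (u n) * a = ∫ t, c t • (expWave (u n) t * a) := by
    intro n
    rw [expTransform, ← integral_mul_const_of_integrable (integrable_smul_expWave hcm hcw (hw n))]
    simp only [smul_mul_assoc]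
  have hlim : ∫ t, c t • a = a := by
    rw [integral_smul_const]
    have : ∫ t, c t = 1 := by
      rw [← h0, expTransform]
      simp [expWave_complex]
    rw [this, one_smul]
  simp only [hint]
  nth_rewrite 2 [← hlim]
  refine tendsto_integral_of_dominated_convergence (fun t => w t * ‖c t‖ * ‖a‖)
    (fun n => hcm.smul ((continuous_expWave _).mul continuous_const).aestronglyMeasurable)
    (hcw.mul_const _) (fun n => .of_forall fun t => ?_) (.of_forall fun t => ?_)
  · rw [norm_smul, mul_comm (w t), mul_assoc]
    gcongr
    exact (norm_mul_le _ _).trans (by gcongr; exact hw n t)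
  · refine Tendsto.const_smul ?_ _
    rw [tendsto_iff_norm_sub_tendsto_zero]
    refine squeeze_zero (fun _ => norm_nonneg _)
      (g := fun n => Real.exp (2 * Real.pi * |t| * R) * (2 * Real.pi * |t| * ‖u n * a‖))
      (fun n => (norm_expWave_mul_sub_self_le _ _ _).trans ?_) ?_
    · gcongr
      exact hR n
    · simpa using (hu.norm.const_mul (2 * Real.pi * |t|)).const_mul _

end Ideal

section Window

theorem norm_expWave_ofReal (x t : ℝ) : ‖expWave (x : ℂ) t‖ = 1 := by
  rw [expWave_complex]
  have : (2 * Real.pi * t * Complex.I * x : ℂ) = ((2 * Real.pi * t * x : ℝ) : ℂ) * Complex.I := by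
    push_cast; ring
  rw [this, Complex.norm_exp_ofReal_mul_I]

theorem expWave_add_mul (x a v t : ℝ) :
    expWave ((x + a * v : ℝ) : ℂ) t = expWave (x : ℂ) t * expWave (v : ℂ) (a * t) := by
  simp only [expWave_complex, ← Complex.exp_add]
  push_cast
  ring_nf

theorem continuous_expWave_uncurry : Continuous fun z : ℝ × ℝ => expWave (z.2 : ℂ) z.1 := by
  simp only [expWave_complex]
  fun_prop

/-- The Fourier transform of the uniform distribution on the unit interval. -/
noncomputable def uniformFourier (s : ℝ) : ℂ := ∫ v in (0 : ℝ)..1, expWave (v : ℂ) s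

theorem continuous_uniformFourier : Continuous uniformFourier :=
  intervalIntegral.continuous_parametric_intervalIntegral_of_continuous'
    continuous_expWave_uncurry 0 1

theorem norm_uniformFourier_le_one (s : ℝ) : ‖uniformFourier s‖ ≤ 1 := by
  have := intervalIntegral.norm_integral_le_of_norm_le_const (a := 0) (b := 1) (C := 1)
    (f := fun v : ℝ => expWave (v : ℂ) s) fun v _ => (norm_expWave_ofReal v s).le
  simpa [uniformFourier] using this

theorem norm_uniformFourier_le_inv {s : ℝ} (hs : s ≠ 0) : ‖uniformFourier s‖ ≤ |s|⁻¹ := by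
  have hc : (2 * Real.pi * s * Complex.I : ℂ) ≠ 0 := by
    simp [Real.pi_ne_zero, hs]
  have h := integral_exp_mul_complex (a := 0) (b := 1) hc
  have h1 : ‖Complex.exp (2 * Real.pi * s * Complex.I)‖ = 1 := by
    have := norm_expWave_ofReal 1 s
    rwa [expWave_complex, Complex.ofReal_one, mul_one] at this
  have h2 : ‖Complex.exp (2 * Real.pi * s * Complex.I) - 1‖ ≤ 2 :=
    (norm_sub_le _ _).trans (by rw [h1, norm_one]; norm_num)
  simp only [uniformFourier, expWave_complex]
  rw [h, norm_div, norm_two_pi_mul_I, Complex.ofReal_zero, Complex.ofReal_one, mul_one, mul_zero,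
    Complex.exp_zero]
  have hs' : 0 < |s| := abs_pos.2 hs
  rw [div_le_iff₀ (by positivity)]
  have h3 : |s|⁻¹ * (2 * Real.pi * |s|) = 2 * Real.pi := by field_simp
  rw [h3]
  linarith [Real.pi_gt_three]

theorem norm_uniformFourier_sub_one_le (s : ℝ) : ‖uniformFourier s - 1‖ ≤ 2 * Real.pi * |s| := by
  have hi : IntervalIntegrable (fun v : ℝ => expWave (v : ℂ) s) volume 0 1 :=
    (continuous_expWave_uncurry.comp (continuous_const.prodMk continuous_id)).intervalIntegrable _ _
  have h : uniformFourier s - 1 = ∫ v in (0 : ℝ)..1, (expWave (v : ℂ) s - 1) := by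
    rw [intervalIntegral.integral_sub hi (by simp)]
    simp [uniformFourier]
  rw [h]
  have := intervalIntegral.norm_integral_le_of_norm_le_const (a := 0) (b := 1)
    (C := 2 * Real.pi * |s|) (f := fun v : ℝ => expWave (v : ℂ) s - 1) fun v hv => by
      rw [Set.uIoc_of_le zero_le_one] at hv
      rw [expWave_complex]
      have h1 : (2 * Real.pi * s * Complex.I * v : ℂ) =
          Complex.I * ((2 * Real.pi * s * v : ℝ) : ℂ) := by
        push_cast; ring
      rw [h1]
      refine (Real.norm_exp_I_mul_ofReal_sub_one_le).trans ?_
      rw [Real.norm_eq_abs, abs_mul, abs_mul, abs_of_pos hv.1, abs_of_pos Real.two_pi_pos]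
      exact mul_le_of_le_one_right (by positivity) hv.2
  simpa using this

theorem expTransform_mul_uniformFourier {c : ℝ → ℂ} (hc : Integrable c) (a x : ℝ) :
    expTransform (fun t => c t * uniformFourier (a * t)) (x : ℂ) =
      ∫ v in (0 : ℝ)..1, expTransform c ((x + a * v : ℝ) : ℂ) := by
  simp only [expTransform, smul_eq_mul]
  rw [intervalIntegral_integral_swap]
  · refine integral_congr_ae (.of_forall fun t => ?_)
    simp only [expWave_add_mul, uniformFourier]
    rw [intervalIntegral.integral_const_mul, intervalIntegral.integral_const_mul]
    ring
  · have : IsFiniteMeasure (volume.restrict (Set.uIoc (0 : ℝ) 1)) := by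
      rw [Set.uIoc_of_le zero_le_one]; infer_instance
    have h1 : Integrable (fun z : ℝ × ℝ => (1 : ℂ) * c z.2)
        ((volume.restrict (Set.uIoc (0 : ℝ) 1)).prod volume) :=
      Integrable.mul_prod (f := fun _ : ℝ => (1 : ℂ)) (integrable_const _) hc
    simp only [one_mul] at h1
    refine h1.mul_bdd (c := 1) ?_ (.of_forall fun z => (norm_expWave_ofReal _ _).le)
    exact (continuous_expWave_uncurry.comp
      (f := fun z : ℝ × ℝ => (z.2, x + a * z.1)) (by fun_prop)).aestronglyMeasurable

theorem continuous_prod_uniformFourier (a : ℕ → ℝ) (m : ℕ) :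
    Continuous fun t => ∏ j ∈ Finset.range m, uniformFourier (a j * t) :=
  continuous_finsetProd _ fun j _ => continuous_uniformFourier.comp (continuous_const_mul (a j))

theorem norm_prod_uniformFourier_le_one (a : ℕ → ℝ) (s : Finset ℕ) (t : ℝ) :
    ‖∏ j ∈ s, uniformFourier (a j * t)‖ ≤ 1 := by
  rw [norm_prod]
  exact Finset.prod_le_one (fun _ _ => norm_nonneg _) fun _ _ => norm_uniformFourier_le_one _

theorem expTransform_mul_prod_uniformFourier_eq {c : ℝ → ℂ} (hc : Integrable c) {a : ℕ → ℝ}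
    (ha : ∀ j, 0 ≤ a j) {w : ℂ} (m : ℕ) {x s : ℝ}
    (hx : ∀ y : ℝ, x ≤ y → y ≤ x + s → expTransform c (y : ℂ) = w)
    (hs : ∑ j ∈ Finset.range m, a j ≤ s) :
    expTransform (fun t => c t * ∏ j ∈ Finset.range m, uniformFourier (a j * t)) (x : ℂ) = w := by
  induction m generalizing x s with
  | zero => simpa using hx x le_rfl (by simpa using hs)
  | succ m ih =>
    simp only [Finset.prod_range_succ, ← mul_assoc]
    have hci : Integrable fun t => c t * ∏ j ∈ Finset.range m, uniformFourier (a j * t) :=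
      hc.mul_bdd (c := 1) (continuous_prod_uniformFourier a m).aestronglyMeasurable
        (.of_forall (norm_prod_uniformFourier_le_one a _))
    rw [expTransform_mul_uniformFourier hci]
    rw [Finset.sum_range_succ] at hs
    have : Set.EqOn (fun v : ℝ => expTransform
        (fun t => c t * ∏ j ∈ Finset.range m, uniformFourier (a j * t)) ((x + a m * v : ℝ) : ℂ))
        (fun _ => w) (Set.uIcc 0 1) := by
      intro v hv
      rw [Set.uIcc_of_le zero_le_one] at hv
      have h0 : 0 ≤ a m * v := mul_nonneg (ha m) hv.1
      have h1 : a m * v ≤ a m := mul_le_of_le_one_right (ha m) hv.2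
      exact ih (s := s - a m) (fun y hy hy' => hx y (by linarith) (by linarith)) (by linarith)
    rw [intervalIntegral.integral_congr this]
    simp

theorem tendsto_prod_uniformFourier {a : ℕ → ℝ} (ha : Summable a) (h0 : ∀ j, 0 ≤ a j) (t : ℝ) :
    Tendsto (fun m => ∏ j ∈ Finset.range m, uniformFourier (a j * t)) atTop
      (𝓝 (∏' j, uniformFourier (a j * t))) := by
  have hs : Summable fun j => ‖uniformFourier (a j * t) - 1‖ := by
    refine (ha.mul_right (2 * Real.pi * |t|)).of_nonneg_of_le (fun _ => norm_nonneg _) fun j =>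
      (norm_uniformFourier_sub_one_le _).trans (le_of_eq ?_)
    rw [abs_mul, abs_of_nonneg (h0 j)]
    ring
  have hm := multipliable_one_add_of_summable hs
  simp only [add_sub_cancel] at hm
  exact hm.hasProd.tendsto_prod_nat

theorem norm_tprod_uniformFourier_le {a : ℕ → ℝ} (ha : Summable a) (h0 : ∀ j, 0 ≤ a j) (t : ℝ)
    (m : ℕ) : ‖∏' j, uniformFourier (a j * t)‖ ≤
      ∏ j ∈ Finset.range m, ‖uniformFourier (a j * t)‖ := by
  refine le_of_tendsto (tendsto_prod_uniformFourier ha h0 t).norm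
    ((eventually_ge_atTop m).mono fun n hn => ?_)
  rw [norm_prod, ← Finset.prod_range_mul_prod_Ico _ hn, ← norm_prod (Finset.Ico m n)]
  exact mul_le_of_le_one_right (Finset.prod_nonneg fun _ _ => norm_nonneg _)
    (norm_prod_uniformFourier_le_one a _ t)

theorem expTransform_mul_tprod_uniformFourier_eq {c : ℝ → ℂ} (hc : Integrable c) {a : ℕ → ℝ}
    (ha : Summable a) (h0 : ∀ j, 0 ≤ a j) {w : ℂ} {x s : ℝ}
    (hx : ∀ y : ℝ, x ≤ y → y ≤ x + s → expTransform c (y : ℂ) = w) (hs : ∑' j, a j ≤ s) :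
    expTransform (fun t => c t * ∏' j, uniformFourier (a j * t)) (x : ℂ) = w := by
  have h : Tendsto (fun m => expTransform
      (fun t => c t * ∏ j ∈ Finset.range m, uniformFourier (a j * t)) (x : ℂ)) atTop
      (𝓝 (expTransform (fun t => c t * ∏' j, uniformFourier (a j * t)) (x : ℂ))) := by
    refine tendsto_integral_of_dominated_convergence (fun t => ‖c t‖)
      (fun m => (hc.1.mul (continuous_prod_uniformFourier a m).aestronglyMeasurable).smul
        (continuous_expWave _).aestronglyMeasurable) hc.norm
      (fun m => .of_forall fun t => ?_) (.of_forall fun t => ?_)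
    · rw [norm_smul, norm_expWave_ofReal, mul_one, norm_mul]
      exact mul_le_of_le_one_right (norm_nonneg _) (norm_prod_uniformFourier_le_one a _ t)
    · exact ((tendsto_prod_uniformFourier ha h0 t).const_mul _).smul_const _
  refine tendsto_nhds_unique h (tendsto_const_nhds.congr fun m => ?_)
  exact (expTransform_mul_prod_uniformFourier_eq hc h0 m hx
    ((ha.sum_le_tsum _ fun j _ => h0 j).trans hs)).symm

theorem norm_tprod_uniformFourier_le_exp {θ δ : ℝ} (hθ : 0 < θ) (hδ : 0 < δ)
    (hs : Summable fun j : ℕ => δ / ((j : ℝ) + 1) ^ θ⁻¹) (t : ℝ) :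
    ‖∏' j : ℕ, uniformFourier (δ / ((j : ℝ) + 1) ^ θ⁻¹ * t)‖ ≤
      Real.exp (1 - (δ * |t| / Real.exp 1) ^ θ) := by
  set Y := (δ * |t| / Real.exp 1) ^ θ with hY
  have hY0 : 0 ≤ Y := by positivity
  refine (norm_tprod_uniformFourier_le hs (fun j => by positivity) t ⌊Y⌋₊).trans ?_
  have h1 : ∀ j ∈ Finset.range ⌊Y⌋₊,
      ‖uniformFourier (δ / ((j : ℝ) + 1) ^ θ⁻¹ * t)‖ ≤ Real.exp (-1) := by
    intro j hj
    have hjY : (j : ℝ) + 1 ≤ Y := by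
      have : j + 1 ≤ ⌊Y⌋₊ := Finset.mem_range.1 hj
      exact_mod_cast (Nat.le_floor_iff hY0).1 this
    have h2 : ((j : ℝ) + 1) ^ θ⁻¹ ≤ δ * |t| / Real.exp 1 := by
      refine (Real.rpow_le_rpow (by positivity) hjY (by positivity)).trans_eq ?_
      rw [hY, ← Real.rpow_mul (by positivity), mul_inv_cancel₀ hθ.ne', Real.rpow_one]
    have hpos : 0 < ((j : ℝ) + 1) ^ θ⁻¹ := by positivity
    have h3 : Real.exp 1 ≤ |δ / ((j : ℝ) + 1) ^ θ⁻¹ * t| := by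
      rw [abs_mul, abs_of_pos (by positivity), div_mul_eq_mul_div, le_div_iff₀ hpos]
      rwa [le_div_iff₀ (Real.exp_pos 1), mul_comm] at h2
    have h4 : δ / ((j : ℝ) + 1) ^ θ⁻¹ * t ≠ 0 :=
      abs_pos.1 ((Real.exp_pos 1).trans_le h3)
    refine (norm_uniformFourier_le_inv h4).trans ?_
    rw [Real.exp_neg]
    gcongr
  refine (Finset.prod_le_prod (fun _ _ => norm_nonneg _) h1).trans ?_
  rw [Finset.prod_const, Finset.card_range, ← Real.exp_nat_mul]
  refine Real.exp_le_exp.2 ?_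
  linarith [Nat.lt_floor_add_one Y]

theorem exists_mul_rpow_sub_rpow_le {γ θ κ K : ℝ} (hγ : 0 < γ) (hγθ : γ < θ) (hκ : 0 < κ)
    (hK : 0 ≤ K) : ∃ L : ℝ, ∀ t : ℝ, K * max 1 |t| ^ γ - (κ * |t|) ^ θ ≤ L := by
  have hlim : Tendsto (fun T : ℝ => κ ^ θ * T ^ (θ - γ)) atTop atTop :=
    (tendsto_rpow_atTop (sub_pos.2 hγθ)).const_mul_atTop (by positivity)
  obtain ⟨T₀, hT₀⟩ := eventually_atTop.1
    ((hlim.eventually_ge_atTop K).and (eventually_ge_atTop (1 : ℝ)))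
  have hT1 : 1 ≤ T₀ := (hT₀ T₀ le_rfl).2
  refine ⟨K * T₀ ^ γ, fun t => ?_⟩
  rcases le_total |t| T₀ with h | h
  · have h1 : K * max 1 |t| ^ γ ≤ K * T₀ ^ γ := by
      gcongr
      exact max_le hT1 h
    have h2 : 0 ≤ (κ * |t|) ^ θ := by positivity
    linarith
  · have ht : 0 < |t| := by linarith
    have h1 := (hT₀ |t| h).1
    have h2 : K * |t| ^ γ ≤ (κ * |t|) ^ θ := by
      rw [Real.mul_rpow hκ.le ht.le]
      calc K * |t| ^ γ ≤ κ ^ θ * |t| ^ (θ - γ) * |t| ^ γ := by gcongr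
        _ = κ ^ θ * |t| ^ θ := by rw [mul_assoc, ← Real.rpow_add ht, sub_add_cancel]
    rw [max_eq_right (hT1.trans h)]
    have h3 : 0 ≤ K * T₀ ^ γ := by positivity
    linarith

theorem exists_integrable_expTransform_eq_bump {r R : ℝ} (hr : 0 < r) (hrR : r < R) :
    ∃ c : ℝ → ℂ, Integrable c ∧ (∀ x : ℝ, |x| ≤ r → expTransform c (x : ℂ) = 1) ∧
      (∀ x : ℝ, R ≤ |x| → expTransform c (x : ℂ) = 0) := by
  let φ : ContDiffBump (0 : ℝ) := ⟨r, R, hr, hrR⟩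
  have hsupp : HasCompactSupport fun x => (φ x : ℂ) :=
    φ.hasCompactSupport.comp_left (g := ((↑) : ℝ → ℂ)) Complex.ofReal_zero
  have hsmooth : ContDiff ℝ (⊤ : ℕ∞) fun x => (φ x : ℂ) :=
    Complex.ofRealCLM.contDiff.comp φ.contDiff
  let f : SchwartzMap ℝ ℂ := hsupp.toSchwartzMap hsmooth
  have hinv : ∀ x : ℝ, expTransform (FourierTransform.fourier f : SchwartzMap ℝ ℂ) (x : ℂ) =
      (φ x : ℂ) := by
    intro x
    have h1 : (FourierTransformInv.fourierInv (FourierTransform.fourier f) : SchwartzMap ℝ ℂ) x =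
        f x := by rw [FourierTransform.fourierInv_fourier_eq]
    rw [SchwartzMap.fourierInv_coe, Real.fourierInv_eq'] at h1
    refine Eq.trans ?_ h1
    refine integral_congr_ae (.of_forall fun t => ?_)
    simp only [expWave_complex, smul_eq_mul]
    rw [mul_comm]
    congr 2
    simp
    ring
  refine ⟨_, (FourierTransform.fourier f : SchwartzMap ℝ ℂ).integrable, fun x hx => ?_,
    fun x hx => ?_⟩
  · rw [hinv, φ.one_of_mem_closedBall (by simpa [φ] using hx), Complex.ofReal_one]
  · rw [hinv, φ.zero_of_le_dist (by simpa [φ] using hx), Complex.ofReal_zero]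

theorem exists_subexponential_window {γ : ℝ} (hγ0 : 0 < γ) (hγ1 : γ < 1) {r R : ℝ} (hr : 0 ≤ r)
    (hrR : r < R) : ∃ c : ℝ → ℂ, AEStronglyMeasurable c ∧
      (∀ K : ℝ, 0 ≤ K → Integrable fun t => Real.exp (K * max 1 |t| ^ γ) * ‖c t‖) ∧
      (∀ x : ℝ, |x| ≤ r → expTransform c (x : ℂ) = 1) ∧
      (∀ x : ℝ, R ≤ |x| → expTransform c (x : ℂ) = 0) := by
  obtain ⟨s, hs, hsR⟩ : ∃ s : ℝ, 0 < s ∧ r + s < R - s :=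
    ⟨(R - r) / 3, by linarith, by linarith⟩
  obtain ⟨c, hc, hc1, hc0⟩ :=
    exists_integrable_expTransform_eq_bump (r := r + s) (R := R - s) (by linarith) hsR
  obtain ⟨θ, hθγ, hθ1⟩ := exists_between hγ1
  have hθ0 : 0 < θ := hγ0.trans hθγ
  have hsum : Summable fun j : ℕ => 1 / ((j : ℝ) + 1) ^ θ⁻¹ := by
    have := (summable_nat_add_iff 1).2
      (Real.summable_one_div_nat_rpow.2 ((one_lt_inv₀ hθ0).2 hθ1))
    simpa using this
  set V := ∑' j : ℕ, 1 / ((j : ℝ) + 1) ^ θ⁻¹ with hV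
  have hV0 : 0 ≤ V := tsum_nonneg fun j => by positivity
  set δ := s / (V + 1) with hδ
  have hδ0 : 0 < δ := by positivity
  have ha : Summable fun j : ℕ => δ / ((j : ℝ) + 1) ^ θ⁻¹ := by
    simpa [div_eq_mul_inv] using hsum.mul_left δ
  have hapos : ∀ j : ℕ, 0 ≤ δ / ((j : ℝ) + 1) ^ θ⁻¹ := fun j => by positivity
  have has : ∑' j : ℕ, δ / ((j : ℝ) + 1) ^ θ⁻¹ ≤ s := by
    have : ∑' j : ℕ, δ / ((j : ℝ) + 1) ^ θ⁻¹ = δ * V := by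
      rw [hV, ← tsum_mul_left]
      simp [div_eq_mul_inv]
    rw [this, hδ, div_mul_eq_mul_div, div_le_iff₀ (by positivity)]
    gcongr
    linarith
  have hP : AEStronglyMeasurable fun t : ℝ =>
      ∏' j : ℕ, uniformFourier (δ / ((j : ℝ) + 1) ^ θ⁻¹ * t) :=
    aestronglyMeasurable_of_tendsto_ae atTop
      (fun m => (continuous_prod_uniformFourier _ m).aestronglyMeasurable)
      (.of_forall fun t => tendsto_prod_uniformFourier ha hapos t)
  refine ⟨fun t => c t * ∏' j : ℕ, uniformFourier (δ / ((j : ℝ) + 1) ^ θ⁻¹ * t), hc.1.mul hP,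
    fun K hK => ?_, fun x hx => ?_, fun x hx => ?_⟩
  · obtain ⟨L, hL⟩ := exists_mul_rpow_sub_rpow_le hγ0 hθγ
      (div_pos hδ0 (Real.exp_pos 1)) hK
    have hcont : Continuous fun t : ℝ => Real.exp (K * max 1 |t| ^ γ) :=
      Real.continuous_exp.comp (continuous_const.mul
        ((continuous_const.max continuous_abs).rpow_const fun _ => .inr hγ0.le))
    refine (hc.norm.const_mul (Real.exp (L + 1))).mono'
      (hcont.aestronglyMeasurable.mul (hc.1.mul hP).norm) (.of_forall fun t => ?_)
    rw [norm_mul, norm_norm, norm_mul, Real.norm_of_nonneg (Real.exp_pos _).le, mul_left_comm,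
      mul_comm (Real.exp (L + 1))]
    gcongr
    calc _ ≤ Real.exp (K * max 1 |t| ^ γ) * Real.exp (1 - (δ * |t| / Real.exp 1) ^ θ) := by
          gcongr
          exact norm_tprod_uniformFourier_le_exp hθ0 hδ0 ha t
      _ ≤ _ := by
          rw [← Real.exp_add, Real.exp_le_exp, mul_div_right_comm]
          linarith [hL t]
  · refine expTransform_mul_tprod_uniformFourier_eq hc ha hapos (s := s) (fun y h1 h2 => hc1 y ?_)
      has
    rw [abs_le] at hx ⊢
    constructor <;> linarith [hx.1, hx.2]
  · refine expTransform_mul_tprod_uniformFourier_eq hc ha hapos (s := s) (fun y h1 h2 => hc0 y ?_)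
      has
    rw [le_abs'] at hx ⊢
    rcases hx with h | h
    · left; linarith
    · right; linarith

end Window

/-- (Barnes-type factorization.) In a unital `(k,p,q)`-differential
subalgebra, if a closed two-sided `*`-ideal `I` has a bounded left approximate identity,
then for every `a ∈ I` and `ε > 0` there are `b₁, b₂ ∈ I` with `‖a − b₁·a‖ < ε` and
`b₂·b₁ = b₁`. -/
theorem stmt12
    {A B : Type*}
    [NormedRing A] [StarRing A] [NormedAlgebra ℂ A] [CompleteSpace A]
    [CStarAlgebra B]
    (hstar : Continuous (star : A → A))
    (ι : A →⋆ₐ[ℂ] B) (hinj : Function.Injective ι) (hcont : Continuous ι)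
    (k : ℕ) (hk : 2 ≤ k) (p q : ℝ) (hp : 0 < p) (hq : 0 < q) (hpq : p + q = (k : ℝ))
    (C : ℝ) (hC : 0 < C)
    (hdiff : ∀ a : A, ‖a ^ k‖ ≤ C * ‖a‖ ^ p * ‖ι a‖ ^ q)
    -- a closed two-sided `*`-ideal `I` of `A`:
    (I : Submodule ℂ A) (hIclosed : IsClosed (I : Set A))
    (hIideal : ∀ (a x : A), x ∈ I → a * x ∈ I ∧ x * a ∈ I)
    (hIstar : ∀ x ∈ I, star x ∈ I)
    -- a bounded left approximate identity for `I`: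
    {J : Type*} (l : Filter J) [l.NeBot] (e : J → A) (heI : ∀ j, e j ∈ I)
    (hbdd : ∃ M : ℝ, ∀ j, ‖e j‖ ≤ M)
    (happrox : ∀ x ∈ I, Filter.Tendsto (fun j => e j * x) l (nhds x)) :
    ∀ a ∈ I, ∀ ε : ℝ, 0 < ε →
      ∃ b₁ ∈ I, ∃ b₂ ∈ I, ‖a - b₁ * a‖ < ε ∧ b₂ * b₁ = b₁ := by
  intro a ha ε hε
  obtain ⟨M, hM⟩ := hbdd
  obtain ⟨S, hS0, hS⟩ : ∃ S : ℝ, 0 ≤ S ∧ ∀ x : A, ‖star x‖ ≤ S * ‖x‖ := by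
    let +nondep : NormedAlgebra ℝ A := .restrictScalars ℝ ℂ A
    let s := (starAddEquiv : A ≃+ A).toAddMonoidHom.toRealLinearMap hstar
    exact ⟨‖s‖, norm_nonneg _, s.le_opNorm⟩
  set Z : ℝ := ‖(1 : A)‖ + M with hZ
  have hz : ∀ j, ‖1 - e j‖ ≤ Z := fun j => (norm_sub_le _ _).trans (by linarith [hM j])
  have hmul : ∀ b x : A, x ∈ I → b * x ∈ I := fun b x hx => (hIideal b x hx).1
  -- a sequence of shifted self-adjoint elements annihilating `a` in the limit
  obtain ⟨u, hua, huR, husa, huI⟩ : ∃ u : ℕ → A, Tendsto (fun n => u n * a) atTop (𝓝 0) ∧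
      (∀ n, ‖u n‖ ≤ S * Z * Z) ∧ (∀ n, IsSelfAdjoint (u n)) ∧ ∀ n, 1 - u n ∈ I := by
    have hza : Tendsto (fun j => ‖(1 - e j) * a‖) l (𝓝 0) := by
      have := ((happrox a ha).const_sub a).norm
      simpa [sub_mul] using this
    choose j hj using fun n : ℕ =>
      ((hza.eventually_lt_const (Nat.one_div_pos_of_nat (α := ℝ) (n := n)))).exists
    refine ⟨fun n => star (1 - e (j n)) * (1 - e (j n)), ?_, fun n => ?_, fun n => ?_, fun n => ?_⟩
    · refine squeeze_zero_norm (a := fun n : ℕ => S * Z * (1 / ((n : ℝ) + 1))) (fun n => ?_) ?_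
      · have hZ0 : 0 ≤ Z := (norm_nonneg _).trans (hz (j n))
        rw [mul_assoc]
        refine (norm_mul_le _ _).trans (mul_le_mul ((hS _).trans ?_) (hj n).le
          (norm_nonneg _) (by positivity))
        gcongr
        exact hz _
      · simpa using tendsto_one_div_add_atTop_nhds_zero_nat.const_mul (S * Z)
    · have hZ0 : 0 ≤ Z := (norm_nonneg _).trans (hz (j n))
      refine (norm_mul_le _ _).trans (mul_le_mul ((hS _).trans ?_) (hz _)
          (norm_nonneg _) (by positivity))
      gcongr
      exact hz _
    · exact .star_mul_self _
    · have : 1 - star (1 - e (j n)) * (1 - e (j n)) =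
          e (j n) + star (e (j n)) - star (e (j n)) * e (j n) := by
        rw [star_sub, star_one]; noncomm_ring
      rw [this]
      exact I.sub_mem (I.add_mem (heI _) (hIstar _ (heI _))) (hmul _ _ (heI _))
  obtain ⟨γ, hγ0, hγ1, hγ⟩ := exists_subexponential_bound hk hp (by linarith) C
  set R := S * Z * Z
  obtain ⟨K, hK0, hK⟩ := hγ (‖(1 : A)‖ +
    Real.exp (2 * Real.pi * k * R) * (2 * Real.pi * k * R * ‖(1 : A)‖))
  have hιsa : ∀ n, IsSelfAdjoint (ι (u n)) := fun n => (husa n).map ι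
  have hw : ∀ n t, ‖expWave (u n) t‖ ≤ Real.exp (K * max 1 |t| ^ γ) := by
    intro n
    refine hK _ (fun t => norm_nonneg _) (fun t ht => ?_) (fun t => ?_)
    · have h := norm_expWave_mul_sub_self_le (u n) 1 t
      rw [mul_one, mul_one] at h
      have h2 := norm_le_insert' (expWave (u n) t) 1
      have hR0 : 0 ≤ R := (norm_nonneg _).trans (huR n)
      refine h2.trans (add_le_add_right (h.trans ?_) _)
      have h3 : ‖u n‖ ≤ R * ‖(1 : A)‖ := by
        calc ‖u n‖ = ‖u n * 1‖ := by rw [mul_one]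
          _ ≤ ‖u n‖ * ‖(1 : A)‖ := norm_mul_le _ _
          _ ≤ _ := by gcongr; exact huR n
      rw [mul_assoc (2 * Real.pi * (k : ℝ)) R]
      gcongr
      exact huR n
    · rw [expWave_nat_mul]
      refine (hdiff _).trans ?_
      have h1 : ι (expWave (u n) t) = expWave (ι (u n)) t :=
        map_expWave (ι : A →ₐ[ℂ] B) hcont _ _
      rw [h1]
      exact mul_le_of_le_one_right (by positivity)
        (Real.rpow_le_one (norm_nonneg _) (norm_expWave_le_one (hιsa n) t) hq.le)
  obtain ⟨c, hcm, hcK, hc1, hc0⟩ :=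
    exists_subexponential_window hγ0 hγ1 (r := 1 / 4) (R := 1 / 2) (by norm_num) (by norm_num)
  obtain ⟨d, hdm, hdK, hd1, hd0⟩ :=
    exists_subexponential_window hγ0 hγ1 (r := 1 / 2) (R := 3 / 4) (by norm_num) (by norm_num)
  have hlim := tendsto_expTransform_mul hcm (hcK K hK0) huR hw
    (by simpa using hc1 0 (by norm_num)) hua
  obtain ⟨n, hn⟩ := ((tendsto_iff_norm_sub_tendsto_zero.1 hlim).eventually_lt_const hε).exists
  have hci := integrable_smul_expWave hcm (hcK K hK0) (hw n)
  have hdi := integrable_smul_expWave hdm (hdK K hK0) (hw n)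
  have integrable_of : ∀ {f : ℝ → ℂ}, AEStronglyMeasurable f →
      (∀ K : ℝ, 0 ≤ K → Integrable fun t => Real.exp (K * max 1 |t| ^ γ) * ‖f t‖) →
      Integrable f := by
    intro f hfm hf
    have := hf 0 le_rfl
    simp only [zero_mul, Real.exp_zero, one_mul] at this
    exact (integrable_norm_iff hfm).1 this
  refine ⟨expTransform c (u n), ?_, expTransform d (u n), ?_, by rwa [norm_sub_rev], hinj ?_⟩
  · exact expTransform_mem hIclosed hmul (huI n) hci (by simpa using hc0 1 (by norm_num))
  · exact expTransform_mem hIclosed hmul (huI n) hdi (by simpa using hd0 1 (by norm_num))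
  · have hmc : ι (expTransform c (u n)) = expTransform c (ι (u n)) :=
      map_expTransform (ι : A →ₐ[ℂ] B) hcont hci
    have hmd : ι (expTransform d (u n)) = expTransform d (ι (u n)) :=
      map_expTransform (ι : A →ₐ[ℂ] B) hcont hdi
    rw [map_mul, hmc, hmd]
    refine expTransform_mul_eq_of_isSelfAdjoint (hιsa n) (integrable_of hcm hcK)
      (integrable_of hdm hdK) fun x => ?_
    rcases le_total |x| (1 / 2) with h | h
    · rw [hd1 x h, one_mul]
    · rw [hc0 x h, mul_zero]
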